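/- arXiv:math/0509320 — 3 statements merged into one kernel-verified Lean document; each statement's English description precedes it below -/
import Mathlib

section
/- Let M be a metric space, let p : ι → M be a family of sites, and fix i ∈ ι. If x ∈ V_i and y ∈ M lies metrically between p_i and x, i.e. dist(p_i, y) + dist(y, x) = dist(p_i, x), then y ∈ V_i. (In particular every shortest path from p_i to a point of V_i stays inside V_i, so V_i is star-shaped with respect to p_i.) -/
/-- The Voronoi cell of site `i` for the family `p` in a metric space. -/
def voronoiCell {ι M : Type*} [MetricSpace M] (p : ι → M) (i : ι) : Set M :=
  {x | ∀ j, dist x (p i) ≤ dist x (p j)}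

/-- If `x ∈ V_i` and `y` lies metrically between `p i` and `x`,
then `y ∈ V_i`; i.e. `V_i` is metrically star-shaped with respect to `p i`. -/
theorem voronoiCell_starShaped_metric {ι M : Type*} [MetricSpace M] (p : ι → M) (i : ι)
    {x y : M} (hx : x ∈ voronoiCell p i)
    (hy : dist (p i) y + dist y x = dist (p i) x) :
    y ∈ voronoiCell p i := by
  intro j
  have hj : dist x (p i) ≤ dist x (p j) := hx j
  have htri : dist x (p j) ≤ dist x y + dist y (p j) := dist_triangle x y (p j)
  rw [dist_comm (p i) y, dist_comm y x, dist_comm (p i) x] at hy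
  linarith
end

section
/- Let E be a real normed vector space and let p : ι → E be a family of sites. Then for every i ∈ ι, the Voronoi cell V_i is star-convex with respect to the site p_i: for every x ∈ V_i, the whole segment [p_i, x] is contained in V_i. -/
/-- In a real normed vector space, each Voronoi cell is star-convex
with respect to its site: the whole segment `[p i, x]` is contained in `V_i`. -/
theorem voronoiCell_starConvex {ι E : Type*} [NormedAddCommGroup E] [NormedSpace ℝ E]
    (p : ι → E) (i : ι) {x : E} (hx : x ∈ voronoiCell p i) :
    ∀ t : ℝ, 0 ≤ t → t ≤ 1 → (1 - t) • p i + t • x ∈ voronoiCell p i := by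
  intro t ht0 ht1 j
  rw [← AffineMap.lineMap_apply_module]
  have hdist : dist x (AffineMap.lineMap (p i) x t) + dist (AffineMap.lineMap (p i) x t) (p i)
      = dist x (p i) := by
    rw [dist_right_lineMap, dist_lineMap_left, Real.norm_of_nonneg ht0,
      Real.norm_of_nonneg (sub_nonneg.2 ht1), dist_comm x (p i)]
    ring
  linarith [hx j, dist_triangle x (AffineMap.lineMap (p i) x t) (p j)]
end

section
/- Let E be a real inner product space and let p : ι → E be a family of pairwise distinct sites. Then for all i ≠ j in ι, the interiors of the Voronoi cells V_i and V_j are disjoint: interior(V_i) ∩ interior(V_j) = ∅. -/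
/-- The interior of the perpendicular bisector of two distinct points is empty. -/
theorem interior_perpBisector_eq_empty {E : Type*} [NormedAddCommGroup E]
    [InnerProductSpace ℝ E] {a b : E} (hab : a ≠ b) :
    interior (AffineSubspace.perpBisector a b : Set E) = ∅ := by
  by_contra h
  have hspan := isOpen_interior.affineSpan_eq_top (Set.nonempty_iff_ne_empty.mpr h)
  have htop : AffineSubspace.perpBisector a b = ⊤ :=
    top_le_iff.mp (hspan ▸ affineSpan_le.mpr interior_subset)
  exact hab (AffineSubspace.perpBisector_eq_top.mp htop)

/-- For pairwise distinct sites in a real inner product space,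
the interiors of distinct Voronoi cells are disjoint. -/
theorem voronoiCell_interiors_disjoint {ι E : Type*} [NormedAddCommGroup E]
    [InnerProductSpace ℝ E] (p : ι → E) (hp : Function.Injective p)
    {i j : ι} (hij : i ≠ j) :
    interior (voronoiCell p i) ∩ interior (voronoiCell p j) = ∅ := by
  rw [← interior_inter, ← Set.subset_empty_iff,
    ← interior_perpBisector_eq_empty (hp.ne hij)]
  exact interior_mono fun x hx =>
    AffineSubspace.mem_perpBisector_iff_dist_eq.mpr (le_antisymm (hx.1 j) (hx.2 i))
end
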